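/- arXiv:2403.19249 — 2 statements merged into one kernel-verified Lean document; each statement's English description precedes it below -/
import Mathlib

section
/- Let X be the set of facet normals of an n-dimensional strongly monotypic polytope (i.e., a finite set X spanning ℝⁿ with 0 in the interior of conv(X), such that no n+1 elements of X are in conical position). Then there exist k pairwise disjoint subsets X₁,…,Xₖ of X such that (i) each Xᵢ is the vertex set of a simplex whose relative interior contains 0, (ii) the linear spans of the Xᵢ are linearly independent subspaces, and (iii) these spans sum directly to ℝⁿ. -/
open scoped RealInnerProductSpace
open Finset

noncomputable section

/-- The positive (conical) hull of a set of vectors: all nonnegative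
linear combinations of finitely many elements of `V`. -/
def posHull {E : Type*} [AddCommGroup E] [Module ℝ E] (V : Set E) : Set E :=
  {y | ∃ (t : Finset E) (c : E → ℝ), ↑t ⊆ V ∧ (∀ z ∈ t, 0 ≤ c z) ∧ ∑ z ∈ t, c z • z = y}

/-- A set of vectors is in conical position if it is strictly separated from `0`
and no element lies in the positive hull of the others. -/
def InConicalPos {n : ℕ} (S : Set (EuclideanSpace ℝ (Fin n))) : Prop :=
  (∃ v : EuclideanSpace ℝ (Fin n), ∀ s ∈ S, 0 < ⟪v, s⟫) ∧
    ∀ s ∈ S, s ∉ posHull (S \ {s})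

lemma exists_pos_dep {n : ℕ} (X : Finset (EuclideanSpace ℝ (Fin n)))
    (h0 : (0 : EuclideanSpace ℝ (Fin n)) ∈
      interior (convexHull ℝ (X : Set (EuclideanSpace ℝ (Fin n))))) :
    ∃ μ : EuclideanSpace ℝ (Fin n) → ℝ, (∀ x ∈ X, 0 < μ x) ∧ ∑ x ∈ X, μ x • x = 0 := by
  have hc : Filter.Tendsto (fun ε : ℝ => -(ε • ∑ x ∈ X, x)) (nhdsWithin 0 (Set.Ioi 0))
      (nhds 0) := by
    have : Continuous (fun ε : ℝ => -(ε • ∑ x ∈ X, x)) := by fun_prop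
    have h := this.tendsto 0
    simp only [zero_smul, neg_zero] at h
    exact h.mono_left nhdsWithin_le_nhds
  have h1 := hc.eventually (mem_interior_iff_mem_nhds.1 h0)
  obtain ⟨ε, hε, hpos⟩ := (h1.and self_mem_nhdsWithin).exists
  obtain ⟨w, hw, -, hs⟩ := Finset.mem_convexHull'.1 hε
  refine ⟨fun x => w x + ε, fun x hx => add_pos_of_nonneg_of_pos (hw x hx) hpos, ?_⟩
  simp only [add_smul, Finset.sum_add_distrib, hs, Finset.smul_sum, neg_add_cancel]

lemma exists_min_dep {E : Type*} [AddCommGroup E] [Module ℝ E] (X : Finset E)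
    (L : Submodule ℝ E) (μ : E → ℝ) (hμ : ∀ x ∈ X, 0 < μ x) (hs : ∑ x ∈ X, μ x • x = 0)
    (hX : ∃ x ∈ X, x ∉ L) :
    ∃ (Y : Finset E) (ν : E → ℝ), Y ⊆ X ∧ Y.Nonempty ∧ (∀ y ∈ Y, y ∉ L) ∧ (∀ y ∈ Y, 0 < ν y) ∧
      ∑ y ∈ Y, ν y • y ∈ L ∧
      ∀ c : E → ℝ, ∑ y ∈ Y, c y • y ∈ L → ∃ t : ℝ, ∀ y ∈ Y, c y = t * ν y := by
  classical
  let P : Finset E → Prop := fun Y => Y.Nonempty ∧ (∀ y ∈ Y, y ∉ L) ∧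
    ∃ ν : E → ℝ, (∀ y ∈ Y, 0 < ν y) ∧ ∑ y ∈ Y, ν y • y ∈ L
  have hne : (X.powerset.filter P).Nonempty := by
    refine ⟨X.filter (· ∉ L), ?_⟩
    simp only [Finset.mem_filter, Finset.mem_powerset, Finset.filter_subset, true_and]
    refine ⟨?_, fun y hy => (Finset.mem_filter.1 hy).2, μ,
      fun y hy => hμ y (Finset.mem_filter.1 hy).1, ?_⟩
    · obtain ⟨x, hx, hxL⟩ := hX
      exact ⟨x, Finset.mem_filter.2 ⟨hx, hxL⟩⟩
    · have h := Finset.sum_filter_add_sum_filter_not X (· ∈ L) (fun x => μ x • x)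
      rw [hs] at h
      rw [eq_neg_of_add_eq_zero_right h]
      exact L.neg_mem (L.sum_mem fun x hx => L.smul_mem _ (Finset.mem_filter.1 hx).2)
  obtain ⟨Y, hY, hmin⟩ := Finset.exists_min_image _ Finset.card hne
  simp only [Finset.mem_filter, Finset.mem_powerset] at hY hmin
  obtain ⟨hYX, hYn, hYL, ν, hν, hνL⟩ := hY
  refine ⟨Y, ν, hYX, hYn, hYL, hν, hνL, fun c hc => ?_⟩
  obtain ⟨y0, hy0, hmax⟩ := Finset.exists_max_image Y (fun y => c y / ν y) hYn
  let t := c y0 / ν y0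
  let d : E → ℝ := fun y => t * ν y - c y
  have hd : ∀ y ∈ Y, 0 ≤ d y := by
    intro y hy
    have := hmax y hy
    rw [div_le_iff₀ (hν y hy)] at this
    exact sub_nonneg.2 this
  have hd0 : d y0 = 0 := by
    have := (hν y0 hy0).ne'
    simp only [d, t]; field_simp; ring
  have hdL : ∑ y ∈ Y, d y • y ∈ L := by
    have : ∑ y ∈ Y, d y • y = t • ∑ y ∈ Y, ν y • y - ∑ y ∈ Y, c y • y := by
      simp only [d, sub_smul, mul_smul, Finset.sum_sub_distrib, Finset.smul_sum]
    rw [this]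
    exact L.sub_mem (L.smul_mem _ hνL) hc
  refine ⟨t, ?_⟩
  by_contra hcon
  push Not at hcon
  obtain ⟨z, hz, hzne⟩ := hcon
  have hZ : P (Y.filter (fun y => 0 < d y)) := by
    refine ⟨⟨z, Finset.mem_filter.2 ⟨hz, lt_of_le_of_ne (hd z hz) ?_⟩⟩,
      fun y hy => hYL y (Finset.mem_filter.1 hy).1, d, fun y hy => (Finset.mem_filter.1 hy).2, ?_⟩
    · intro h
      apply hzne
      simp only [d] at h
      linarith
    · convert hdL using 1
      apply Finset.sum_subset (Finset.filter_subset _ _)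
      intro x hx hx'
      simp only [Finset.mem_filter, not_and, not_lt] at hx'
      rw [le_antisymm (hx' hx) (hd x hx), zero_smul]
  have := hmin _ ⟨(Finset.filter_subset _ _).trans hYX, hZ⟩
  have h2 : (Y.filter (fun y => 0 < d y)).card < Y.card := by
    apply Finset.card_lt_card
    refine Finset.filter_ssubset.2 ⟨y0, hy0, ?_⟩
    simp [hd0]
  omega

lemma no_bad_circuit {n : ℕ} (X : Finset (EuclideanSpace ℝ (Fin n)))
    (hspan : Submodule.span ℝ (X : Set (EuclideanSpace ℝ (Fin n))) = ⊤)
    (hcon : ∀ S : Finset (EuclideanSpace ℝ (Fin n)),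
      S ⊆ X → S.card = n + 1 → ¬ InConicalPos (S : Set (EuclideanSpace ℝ (Fin n))))
    (T : Finset (EuclideanSpace ℝ (Fin n))) (hT : T ⊆ X) (w : EuclideanSpace ℝ (Fin n) → ℝ)
    (hw0 : ∀ x, x ∉ T → w x = 0) (hw : ∑ x ∈ T, w x • x = 0)
    (huniq : ∀ c : EuclideanSpace ℝ (Fin n) → ℝ, ∑ x ∈ T, c x • x = 0 →
      ∃ t : ℝ, ∀ x ∈ T, c x = t * w x)
    (p1 p2 q1 q2 : EuclideanSpace ℝ (Fin n)) (hp : p1 ≠ p2) (hq : q1 ≠ q2)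
    (hp1 : 0 < w p1) (hp2 : 0 < w p2) (hq1 : w q1 < 0) (hq2 : w q2 < 0) : False := by
  classical
  have memT : ∀ x, w x ≠ 0 → x ∈ T := fun x hx => by
    by_contra h
    exact hx (hw0 x h)
  have hp1T := memT p1 hp1.ne'
  have hli : LinearIndepOn ℝ id ((T.erase p1 : Finset _) : Set (EuclideanSpace ℝ (Fin n))) := by
    rw [linearIndepOn_finset_iff]
    intro c hc x hx
    let c' := fun x => if x = p1 then 0 else c x
    have h1 : ∑ x ∈ T, c' x • x = 0 := by
      rw [← Finset.add_sum_erase _ _ hp1T, ← hc]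
      simp only [c', if_true, zero_smul, zero_add]
      refine Finset.sum_congr rfl fun y hy => ?_
      simp [Finset.ne_of_mem_erase hy]
    obtain ⟨t, ht⟩ := huniq c' h1
    have h2 := ht p1 hp1T
    simp only [c', if_true] at h2
    have ht0 : t = 0 := by
      rcases mul_eq_zero.1 h2.symm with h | h
      · exact h
      · exact absurd h hp1.ne'
    have h3 := ht x (Finset.mem_of_mem_erase hx)
    simpa [c', Finset.ne_of_mem_erase hx, ht0] using h3
  obtain ⟨b, hbX, hTb, hXb, hbli⟩ := exists_linearIndepOn_extension hli
    (t := (X : Set (EuclideanSpace ℝ (Fin n))))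
    (Finset.coe_subset.2 ((Finset.erase_subset _ _).trans hT))
  obtain ⟨B, rfl⟩ : ∃ B : Finset (EuclideanSpace ℝ (Fin n)), (B : Set _) = b :=
    ⟨(X.finite_toSet.subset hbX).toFinset, by simp⟩
  simp only [Set.image_id] at hXb
  have hBtop : Submodule.span ℝ (B : Set (EuclideanSpace ℝ (Fin n))) = ⊤ := by
    rw [eq_top_iff, ← hspan]
    exact Submodule.span_le.2 hXb
  have hBcard : B.card = n := by
    rw [← finrank_span_finset_eq_card hbli, hBtop, finrank_top, finrank_euclideanSpace_fin]
  have hTB : T.erase p1 ⊆ B := Finset.coe_subset.1 hTb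
  rw [linearIndepOn_finset_iff] at hbli
  have hTins : T ⊆ insert p1 B := by
    intro x hx
    by_cases h : x = p1
    · simp [h]
    · exact Finset.mem_insert_of_mem (hTB (Finset.mem_erase.2 ⟨h, hx⟩))
  have hp1B : p1 ∉ B := by
    intro h
    have hTB' : T ⊆ B := hTins.trans (by simp [h])
    have := hbli w (by rw [← Finset.sum_subset hTB' (fun x _ hx => by simp [hw0 x hx])]; exact hw) p1 h
    exact hp1.ne' this
  have hwS : ∑ x ∈ insert p1 B, w x • x = 0 := by
    rw [← Finset.sum_subset hTins (fun x _ hx => by simp [hw0 x hx])]; exact hw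
  have hdep : w p1 • p1 + ∑ x ∈ B, w x • x = 0 := by
    rwa [Finset.sum_insert hp1B] at hwS
  have huS : ∀ c : EuclideanSpace ℝ (Fin n) → ℝ, ∑ x ∈ insert p1 B, c x • x = 0 →
      ∃ t : ℝ, ∀ x ∈ insert p1 B, c x = t * w x := by
    intro c hc
    have e1 : c p1 - c p1 / w p1 * w p1 = 0 := by field_simp; ring
    have h1 : ∑ x ∈ insert p1 B, (c x - c p1 / w p1 * w x) • x = 0 := by
      simp only [sub_smul, mul_smul, Finset.sum_sub_distrib, ← Finset.smul_sum, hc, hwS]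
      simp
    rw [Finset.sum_insert hp1B, e1, zero_smul, zero_add] at h1
    refine ⟨c p1 / w p1, fun x hx => ?_⟩
    rcases Finset.mem_insert.1 hx with rfl | hx
    · linarith
    · have : c x - c p1 / w p1 * w x = 0 := hbli (fun x => c x - c p1 / w p1 * w x) h1 x hx
      linarith
  refine hcon (insert p1 B) ?_ (by rw [Finset.card_insert_of_notMem hp1B, hBcard]) ⟨?_, ?_⟩
  · intro x hx
    rcases Finset.mem_insert.1 hx with rfl | hx
    · exact hT hp1T
    · exact hbX hx
  · -- separating functional
    have hq1B : q1 ∈ B := hTB (Finset.mem_erase.2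
      ⟨fun h => by rw [h] at hq1; linarith, memT q1 hq1.ne⟩)
    let K : ℝ := max 1 ((∑ x ∈ B.erase q1, w x + 1) / (- w q1))
    let f : EuclideanSpace ℝ (Fin n) → ℝ := fun x => if x = q1 then K else 1
    have hf : ∀ x, 0 < f x := by
      intro x
      have : 0 < K := lt_of_lt_of_le one_pos (le_max_left _ _)
      simp only [f]
      split_ifs <;> [exact this; exact one_pos]
    have hsum : ∑ x ∈ B, w x * f x < 0 := by
      rw [← Finset.add_sum_erase _ _ hq1B]
      have h1 : ∑ x ∈ B.erase q1, w x * f x = ∑ x ∈ B.erase q1, w x :=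
        Finset.sum_congr rfl fun y hy => by simp [f, Finset.ne_of_mem_erase hy]
      have h2 : (∑ x ∈ B.erase q1, w x + 1) / (- w q1) ≤ K := le_max_right _ _
      rw [div_le_iff₀ (by linarith)] at h2
      rw [h1]
      simp only [f, if_true]
      linarith
    have hbli' : LinearIndependent ℝ
        (fun x : B => (x : EuclideanSpace ℝ (Fin n))) := by
      have : LinearIndepOn ℝ id (B : Set (EuclideanSpace ℝ (Fin n))) := by
        rw [linearIndepOn_finset_iff]; exact hbli
      exact this
    let bs := Module.Basis.mk hbli' (by rw [← hBtop]; apply Submodule.span_mono; intro x hx; exact ⟨⟨x, hx⟩, rfl⟩)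
    let φ := bs.constr ℝ (fun x : B => f x)
    have hφ : ∀ x ∈ B, φ x = f x := by
      intro x hx
      have := bs.constr_basis ℝ (fun x : B => f x) ⟨x, hx⟩
      simpa [bs, φ] using this
    refine ⟨(InnerProductSpace.toDual ℝ _).symm (LinearMap.toContinuousLinearMap φ), ?_⟩
    intro s hs
    rw [InnerProductSpace.toDual_symm_apply]
    simp only [LinearMap.coe_toContinuousLinearMap']
    rcases Finset.mem_insert.1 hs with rfl | hs
    · have h1 := congrArg φ hdep
      simp only [map_add, map_sum, map_smul, map_zero, smul_eq_mul] at h1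
      rw [Finset.sum_congr rfl (fun x hx => by rw [hφ x hx])] at h1
      by_contra hneg
      have : w s * φ s ≤ 0 := mul_nonpos_of_nonneg_of_nonpos hp1.le (not_lt.1 hneg)
      linarith
    · rw [hφ s hs]; exact hf s
  · rintro s hs ⟨t, c, htS, hc, hsum⟩
    have hsS : s ∈ insert p1 B := hs
    have ht : t ⊆ insert p1 B := fun x hx => (htS hx).1
    have hst : s ∉ t := fun h => (htS h).2 rfl
    let d : EuclideanSpace ℝ (Fin n) → ℝ := fun x => (if x ∈ t then c x else 0) - if x = s then 1 else 0
    have hd : ∑ x ∈ insert p1 B, d x • x = 0 := by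
      simp only [d, sub_smul, Finset.sum_sub_distrib, ite_smul, zero_smul, one_smul]
      rw [Finset.sum_ite_eq' (insert p1 B) s, if_pos hsS, ← Finset.sum_filter,
        Finset.filter_mem_eq_inter, Finset.inter_eq_right.2 ht, hsum, sub_self]
    obtain ⟨τ, hτ⟩ := huS d hd
    have hds : d s = -1 := by simp [d, hst]
    have hdn : ∀ x, x ≠ s → 0 ≤ d x := by
      intro x hx
      simp only [d, hx, if_false, sub_zero]
      split_ifs with h
      · exact hc x h
      · exact le_rfl
    have key : ∀ x, x ∈ insert p1 B → τ * w x < 0 → x = s := by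
      intro x hx h
      by_contra hne
      have := hdn x hne
      rw [hτ x hx] at this
      linarith
    rcases lt_trichotomy τ 0 with h | h | h
    · exact hp ((key p1 (hTins hp1T) (mul_neg_of_neg_of_pos h hp1)).trans
        (key p2 (hTins (memT p2 hp2.ne')) (mul_neg_of_neg_of_pos h hp2)).symm)
    · have := hτ s hsS
      rw [h, hds] at this
      linarith
    · exact hq ((key q1 (hTins (memT q1 hq1.ne)) (mul_neg_of_pos_of_neg h hq1)).trans
        (key q2 (hTins (memT q2 hq2.ne)) (mul_neg_of_pos_of_neg h hq2)).symm)

/-- A spanning-direct-sum family of positive circuits, encoded by labels `f`. -/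
structure GoodFam {E : Type*} [AddCommGroup E] [Module ℝ E] (X U : Finset E) (f : E → ℕ)
    (μ : E → ℝ) : Prop where
  sub : U ⊆ X
  pos : ∀ x ∈ U, 0 < μ x
  cls : ∀ i, ∑ x ∈ U with f x = i, μ x • x = 0
  uniq : ∀ c : E → ℝ, ∑ x ∈ U, c x • x = 0 → ∃ s : ℕ → ℝ, ∀ x ∈ U, c x = s (f x) * μ x

lemma GoodFam.sum_eq {E : Type*} [AddCommGroup E] [Module ℝ E] {X U : Finset E} {f : E → ℕ}
    {μ : E → ℝ} (h : GoodFam X U f μ) (s : ℕ → ℝ) : ∑ x ∈ U, (s (f x) * μ x) • x = 0 := by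
  classical
  rw [← Finset.sum_fiberwise_of_maps_to (t := U.image f) (g := f)
    (fun x hx => Finset.mem_image_of_mem f hx)]
  refine Finset.sum_eq_zero fun i _ => ?_
  have : ∑ x ∈ U with f x = i, (s (f x) * μ x) • x = s i • ∑ x ∈ U with f x = i, μ x • x := by
    rw [Finset.smul_sum]
    refine Finset.sum_congr rfl fun x hx => ?_
    rw [(Finset.mem_filter.1 hx).2, mul_smul]
  rw [this, h.cls i, smul_zero]

lemma GoodFam.step {n : ℕ} {X : Finset (EuclideanSpace ℝ (Fin n))}
    (hspan : Submodule.span ℝ (X : Set (EuclideanSpace ℝ (Fin n))) = ⊤)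
    (h0 : (0 : EuclideanSpace ℝ (Fin n)) ∈
      interior (convexHull ℝ (X : Set (EuclideanSpace ℝ (Fin n)))))
    (hcon : ∀ S : Finset (EuclideanSpace ℝ (Fin n)),
      S ⊆ X → S.card = n + 1 → ¬ InConicalPos (S : Set (EuclideanSpace ℝ (Fin n))))
    {U : Finset (EuclideanSpace ℝ (Fin n))} {f : EuclideanSpace ℝ (Fin n) → ℕ}
    {μ : EuclideanSpace ℝ (Fin n) → ℝ} (h : GoodFam X U f μ)
    (hU : Submodule.span ℝ (U : Set (EuclideanSpace ℝ (Fin n))) ≠ ⊤) :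
    ∃ U' f' μ', GoodFam X U' f' μ' ∧ Submodule.span ℝ (U : Set (EuclideanSpace ℝ (Fin n))) <
      Submodule.span ℝ (U' : Set (EuclideanSpace ℝ (Fin n))) := by
  classical
  obtain ⟨κ, hκ, hκ0⟩ := exists_pos_dep X h0
  have hex : ∃ x ∈ X, x ∉ Submodule.span ℝ (U : Set (EuclideanSpace ℝ (Fin n))) := by
    by_contra hno
    push Not at hno
    apply hU
    rw [eq_top_iff, ← hspan]
    exact Submodule.span_le.2 hno
  obtain ⟨Y, ν, hYX, ⟨y0, hy0⟩, hYL, hν, hνL, hYu⟩ := exists_min_dep X _ κ hκ hκ0 hex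
  set L := Submodule.span ℝ (U : Set (EuclideanSpace ℝ (Fin n))) with hL
  have memL : ∀ x ∈ U, x ∈ L := fun x hx => Submodule.subset_span hx
  have sumL : ∀ (V : Finset (EuclideanSpace ℝ (Fin n))) (c : EuclideanSpace ℝ (Fin n) → ℝ),
      V ⊆ U → ∑ x ∈ V, c x • x ∈ L :=
    fun V c hV => L.sum_mem fun x hx => L.smul_mem _ (memL x (hV hx))
  have hdis : ∀ x, x ∈ Y → x ∉ U := fun x hx hxU => hYL x hx (memL x hxU)
  -- Y has two elements
  obtain ⟨y1, hy1, hy01⟩ : ∃ y1 ∈ Y, y0 ≠ y1 := by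
    by_contra hno
    push Not at hno
    have : Y = {y0} := by
      ext y
      rw [Finset.mem_singleton]
      exact ⟨fun hy => (hno y hy).symm, fun hy => hy ▸ hy0⟩
    rw [this, Finset.sum_singleton] at hνL
    exact hYL y0 hy0 ((L.smul_mem_iff (hν y0 hy0).ne').1 hνL)
  obtain ⟨g, -, hg⟩ := Submodule.mem_span_finset.1 hνL
  have hm : ∀ i, ∃ m : ℝ, (∀ x ∈ U, f x = i → m * μ x ≤ g x) ∧
      ((∃ x ∈ U, f x = i) → ∃ x ∈ U, f x = i ∧ g x = m * μ x) := by
    intro i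
    by_cases hi : ∃ x ∈ U, f x = i
    · obtain ⟨x, hx, hxi⟩ := hi
      obtain ⟨z, hz, hmin⟩ := Finset.exists_min_image (U.filter (f · = i)) (fun x => g x / μ x)
        ⟨x, Finset.mem_filter.2 ⟨hx, hxi⟩⟩
      rw [Finset.mem_filter] at hz
      refine ⟨g z / μ z, fun y hy hyi => ?_, fun _ => ⟨z, hz.1, hz.2, ?_⟩⟩
      · have := hmin y (Finset.mem_filter.2 ⟨hy, hyi⟩)
        rwa [le_div_iff₀ (h.pos y hy)] at this
      · have := (h.pos z hz.1).ne'
        field_simp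
    · exact ⟨0, fun x hx hxi => absurd ⟨x, hx, hxi⟩ hi, fun h => absurd h hi⟩
  choose m hm1 hm2 using hm
  let r : EuclideanSpace ℝ (Fin n) → ℝ := fun x => g x - m (f x) * μ x
  have hr0 : ∀ x ∈ U, 0 ≤ r x := fun x hx => sub_nonneg.2 (hm1 _ x hx rfl)
  have hrsum : ∑ x ∈ U, r x • x = ∑ y ∈ Y, ν y • y := by
    simp only [r, sub_smul, Finset.sum_sub_distrib, hg, h.sum_eq m, sub_zero]
  let N := U.filter (fun x => 0 < r x)
  have hNU : N ⊆ U := Finset.filter_subset _ _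
  have hrN : ∀ x ∈ U, x ∉ N → r x = 0 := by
    intro x hx hxN
    simp only [N, Finset.mem_filter, not_and, not_lt] at hxN
    exact le_antisymm (hxN hx) (hr0 x hx)
  have hNsum : ∑ x ∈ N, r x • x = ∑ y ∈ Y, ν y • y := by
    rw [← hrsum]
    exact Finset.sum_subset hNU fun x hx hxN => by rw [hrN x hx hxN, zero_smul]
  have hYN : Disjoint Y N := Finset.disjoint_left.2 fun x hx hxN => hdis x hx (hNU hxN)
  have hYU : Disjoint Y U := Finset.disjoint_left.2 fun x hx => hdis x hx
  -- N has at most one element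
  have hN1 : ∀ a ∈ N, ∀ b ∈ N, a = b := by
    intro a ha b hb
    by_contra hab
    let w : EuclideanSpace ℝ (Fin n) → ℝ := fun x => if x ∈ Y then ν x else if x ∈ N then - r x else 0
    have hwY : ∀ x ∈ Y, w x = ν x := fun x hx => by simp [w, hx]
    have hwN : ∀ x ∈ N, w x = - r x := fun x hx => by
      have hxY : x ∉ Y := fun h' => hdis x h' (hNU hx)
      simp [w, hx, hxY]
    have hrpos : ∀ x ∈ N, 0 < r x := fun x hx => (Finset.mem_filter.1 hx).2
    have hYw : ∑ x ∈ Y, w x • x = ∑ x ∈ Y, ν x • x :=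
      Finset.sum_congr rfl fun x hx => by rw [hwY x hx]
    have hNw : ∑ x ∈ N, w x • x = - ∑ x ∈ N, r x • x := by
      rw [← Finset.sum_neg_distrib]
      exact Finset.sum_congr rfl fun x hx => by rw [hwN x hx, neg_smul]
    have hwsum : ∑ x ∈ Y ∪ N, w x • x = 0 := by
      rw [Finset.sum_union hYN, hYw, hNw, hNsum, add_neg_cancel]
    refine no_bad_circuit X hspan hcon (Y ∪ N) (Finset.union_subset hYX (hNU.trans h.sub)) w
      ?_ hwsum ?_ y0 y1 a b hy01 hab ?_ ?_ ?_ ?_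
    · intro x hx
      simp only [Finset.mem_union, not_or] at hx
      simp [w, hx.1, hx.2]
    · intro c hc
      obtain ⟨t, ht⟩ := hYu c (by
        rw [Finset.sum_union hYN] at hc
        rw [eq_neg_of_add_eq_zero_left hc]
        exact L.neg_mem (sumL N c hNU))
      refine ⟨t, ?_⟩
      have hd : ∑ x ∈ Y ∪ N, (c x - t * w x) • x = 0 := by
        simp only [sub_smul, mul_smul, Finset.sum_sub_distrib, ← Finset.smul_sum, hc, hwsum]
        simp
      rw [Finset.sum_union hYN, Finset.sum_eq_zero (s := Y), zero_add] at hd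
      · let d : EuclideanSpace ℝ (Fin n) → ℝ := fun x => if x ∈ N then c x - t * w x else 0
        have hdU : ∑ x ∈ U, d x • x = 0 := by
          rw [← Finset.sum_subset hNU fun x _ hxN => by simp [d, hxN], ← hd]
          exact Finset.sum_congr rfl fun x hx => by simp [d, hx]
        obtain ⟨s, hs⟩ := h.uniq d hdU
        have hs0 : ∀ x ∈ U, s (f x) = 0 := by
          intro x hx
          obtain ⟨z, hz, hzf, hzg⟩ := hm2 (f x) ⟨x, hx, rfl⟩
          have hzN : z ∉ N := by
            intro hzN
            have := hrpos z hzN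
            simp only [r, hzf, hzg, sub_self, lt_irrefl] at this
          have h1 := hs z hz
          simp only [d, hzN, if_false, hzf] at h1
          rcases mul_eq_zero.1 h1.symm with h2 | h2
          · exact h2
          · exact absurd h2 (h.pos z hz).ne'
        intro x hx
        rcases Finset.mem_union.1 hx with hx | hx
        · rw [ht x hx, hwY x hx]
        · have h1 := hs x (hNU hx)
          rw [hs0 x (hNU hx), zero_mul] at h1
          simp only [d, hx, if_true] at h1
          linarith
      · intro x hx
        rw [ht x hx, hwY x hx, sub_self, zero_smul]
    · rw [hwY y0 hy0]; exact hν y0 hy0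
    · rw [hwY y1 hy1]; exact hν y1 hy1
    · rw [hwN a ha]; have := hrpos a ha; linarith
    · rw [hwN b hb]; have := hrpos b hb; linarith
  have hlt : ∀ U' : Finset (EuclideanSpace ℝ (Fin n)), Y ⊆ U' →
      (∀ x ∈ U, x ∈ Submodule.span ℝ (U' : Set (EuclideanSpace ℝ (Fin n)))) →
      L < Submodule.span ℝ (U' : Set (EuclideanSpace ℝ (Fin n))) := by
    intro U' hY' hUU'
    refine lt_of_le_of_ne (Submodule.span_le.2 hUU') fun heq => hYL y0 hy0 ?_
    rw [heq]
    exact Submodule.subset_span (hY' hy0)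
  rcases N.eq_empty_or_nonempty with hNe | ⟨b, hb⟩
  · -- add Y as a new class
    have hY0 : ∑ y ∈ Y, ν y • y = 0 := by rw [← hNsum, hNe, Finset.sum_empty]
    obtain ⟨l, hl⟩ := Infinite.exists_notMem_finset (U.image f)
    have hlU : ∀ x ∈ U, f x ≠ l := fun x hx hxl => hl (Finset.mem_image.2 ⟨x, hx, hxl⟩)
    have hnY : ∀ x ∈ U, x ∉ Y := fun x hx hxY => hdis x hxY hx
    refine ⟨Y ∪ U, fun x => if x ∈ Y then l else f x, fun x => if x ∈ Y then ν x else μ x,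
      ⟨Finset.union_subset hYX h.sub, ?_, ?_, ?_⟩, hlt _ Finset.subset_union_left
        fun x hx => Submodule.subset_span (by simp [hx])⟩
    · intro x hx
      by_cases hxY : x ∈ Y
      · simpa [hxY] using hν x hxY
      · simpa [hxY] using h.pos x (by simpa [hxY] using hx)
    · intro i
      rw [Finset.sum_filter, Finset.sum_union hYU]
      have e1 : ∑ x ∈ U, (if (if x ∈ Y then l else f x) = i then
          (if x ∈ Y then ν x else μ x) • x else 0) = 0 := by
        refine Eq.trans ?_ ((Finset.sum_filter _ _).symm.trans (h.cls i))
        exact Finset.sum_congr rfl fun x hx => by simp [hnY x hx]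
      have e2 : ∑ x ∈ Y, (if (if x ∈ Y then l else f x) = i then
          (if x ∈ Y then ν x else μ x) • x else 0) = 0 := by
        by_cases hi : l = i
        · rw [← hY0]
          exact Finset.sum_congr rfl fun x hx => by simp [hx, hi]
        · exact Finset.sum_eq_zero fun x hx => by simp [hx, hi]
      rw [e1, e2, add_zero]
    · intro c hc
      rw [Finset.sum_union hYU] at hc
      obtain ⟨t, ht⟩ := hYu c (by
        rw [eq_neg_of_add_eq_zero_left hc]
        exact L.neg_mem (sumL U c subset_rfl))
      have e1 : ∑ x ∈ Y, c x • x = 0 := by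
        have : ∑ x ∈ Y, c x • x = t • ∑ x ∈ Y, ν x • x := by
          rw [Finset.smul_sum]
          exact Finset.sum_congr rfl fun x hx => by rw [ht x hx, mul_smul]
        rw [this, hY0, smul_zero]
      rw [e1, zero_add] at hc
      obtain ⟨s, hs⟩ := h.uniq c hc
      refine ⟨fun j => if j = l then t else s j, fun x hx => ?_⟩
      by_cases hxY : x ∈ Y
      · simpa [hxY] using ht x hxY
      · have hxU : x ∈ U := by simpa [hxY] using hx
        simpa [hxY, hlU x hxU] using hs x hxU
  · -- replace b by Y
    have hbU := hNU hb
    have hrb : 0 < r b := (Finset.mem_filter.1 hb).2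
    have hNb : N = {b} := by
      ext y
      rw [Finset.mem_singleton]
      exact ⟨fun hy => hN1 y hy b hb, fun hy => hy ▸ hb⟩
    rw [hNb, Finset.sum_singleton] at hNsum
    have hμb := h.pos b hbU
    let γ := μ b / r b
    have hγ : 0 < γ := div_pos hμb hrb
    have hYb : ∑ y ∈ Y, (γ * ν y) • y = μ b • b := by
      simp only [mul_smul, ← Finset.smul_sum, ← hNsum]
      rw [smul_smul]
      congr 1
      simp only [γ]; field_simp
    have hnY : ∀ x ∈ U, x ∉ Y := fun x hx hxY => hdis x hxY hx
    have hYU' : Disjoint Y (U.erase b) := hYU.mono_right (Finset.erase_subset _ _)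
    have hclsb : ∀ i, ∑ x ∈ U.erase b, (if f x = i then μ x • x else 0) =
        - if f b = i then μ b • b else 0 := by
      intro i
      have := h.cls i
      rw [Finset.sum_filter, ← Finset.add_sum_erase _ _ hbU] at this
      exact eq_neg_of_add_eq_zero_right this
    refine ⟨Y ∪ U.erase b, fun x => if x ∈ Y then f b else f x,
      fun x => if x ∈ Y then γ * ν x else μ x,
      ⟨Finset.union_subset hYX ((Finset.erase_subset _ _).trans h.sub), ?_, ?_, ?_⟩,
      hlt _ Finset.subset_union_left ?_⟩
    · intro x hx
      by_cases hxY : x ∈ Y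
      · simpa [hxY] using mul_pos hγ (hν x hxY)
      · have hx' : x ∈ U.erase b := by
          rcases Finset.mem_union.1 hx with h' | h'
          · exact absurd h' hxY
          · exact h'
        simpa [hxY] using h.pos x (Finset.mem_of_mem_erase hx')
    · intro i
      rw [Finset.sum_filter, Finset.sum_union hYU']
      have e1 : ∑ x ∈ U.erase b, (if (if x ∈ Y then f b else f x) = i then
          (if x ∈ Y then γ * ν x else μ x) • x else 0) = - if f b = i then μ b • b else 0 := by
        rw [← hclsb i]
        exact Finset.sum_congr rfl fun x hx => by simp [hnY x (Finset.mem_of_mem_erase hx)]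
      have e2 : ∑ x ∈ Y, (if (if x ∈ Y then f b else f x) = i then
          (if x ∈ Y then γ * ν x else μ x) • x else 0) = if f b = i then μ b • b else 0 := by
        by_cases hi : f b = i
        · rw [if_pos hi, ← hYb]
          exact Finset.sum_congr rfl fun x hx => by simp [hx, hi]
        · rw [if_neg hi]
          exact Finset.sum_eq_zero fun x hx => by simp [hx, hi]
      rw [e1, e2, add_neg_cancel]
    · intro c hc
      rw [Finset.sum_union hYU'] at hc
      obtain ⟨t, ht⟩ := hYu c (by
        rw [eq_neg_of_add_eq_zero_left hc]
        exact L.neg_mem (sumL _ c (Finset.erase_subset _ _)))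
      have ht' : ∀ y ∈ Y, c y = (t / γ) * (γ * ν y) := by
        intro y hy
        rw [ht y hy]
        field_simp
      have e1 : ∑ x ∈ Y, c x • x = (t / γ * μ b) • b := by
        have : ∑ x ∈ Y, c x • x = (t / γ) • ∑ x ∈ Y, (γ * ν x) • x := by
          rw [Finset.smul_sum]
          exact Finset.sum_congr rfl fun x hx => by rw [ht' x hx, mul_smul]
        rw [this, hYb, smul_smul]
      have e2 : ∑ x ∈ U, (if x = b then t / γ * μ b else c x) • x = 0 := by
        rw [← Finset.add_sum_erase _ _ hbU, ← hc, e1, if_pos rfl]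
        congr 1
        exact Finset.sum_congr rfl fun x hx => by simp [Finset.ne_of_mem_erase hx]
      obtain ⟨s, hs⟩ := h.uniq _ e2
      have hsb : t / γ = s (f b) := by
        have := hs b hbU
        rw [if_pos rfl] at this
        exact mul_right_cancel₀ hμb.ne' this
      refine ⟨s, fun x hx => ?_⟩
      by_cases hxY : x ∈ Y
      · simpa [hxY, hsb] using ht' x hxY
      · have hx' : x ∈ U.erase b := by
          rcases Finset.mem_union.1 hx with h' | h'
          · exact absurd h' hxY
          · exact h'
        have := hs x (Finset.mem_of_mem_erase hx')
        simpa [hxY, Finset.ne_of_mem_erase hx'] using this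
    · intro x hx
      by_cases hxb : x = b
      · rw [hxb]
        have : μ b • b ∈ Submodule.span ℝ
            ((Y ∪ U.erase b : Finset _) : Set (EuclideanSpace ℝ (Fin n))) := by
          rw [← hYb]
          exact Submodule.sum_mem _ fun y hy => Submodule.smul_mem _ _
            (Submodule.subset_span (Finset.mem_coe.2 (Finset.mem_union_left _ hy)))
        exact (Submodule.smul_mem_iff _ hμb.ne').1 this
      · exact Submodule.subset_span (by simp [hx, hxb])

/-- Theorem 5 (skeleton): the normals of a strongly monotypic polytope contain disjoint
subsets `X₁, …, Xₖ`, each the vertex set of a simplex with `0` in its relative interior,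
whose linear spans are independent and sum directly to `ℝⁿ`. -/
theorem stmt5 {n : ℕ} (X : Finset (EuclideanSpace ℝ (Fin n)))
    (hspan : Submodule.span ℝ (X : Set (EuclideanSpace ℝ (Fin n))) = ⊤)
    (h0 : (0 : EuclideanSpace ℝ (Fin n)) ∈
      interior (convexHull ℝ (X : Set (EuclideanSpace ℝ (Fin n)))))
    (hcon : ∀ S : Finset (EuclideanSpace ℝ (Fin n)),
      S ⊆ X → S.card = n + 1 → ¬ InConicalPos (S : Set (EuclideanSpace ℝ (Fin n)))) :
    ∃ (k : ℕ) (Xs : Fin k → Finset (EuclideanSpace ℝ (Fin n))),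
      (∀ i, Xs i ⊆ X) ∧
      (∀ i j, i ≠ j → Disjoint (Xs i) (Xs j)) ∧
      -- (i) each `Xs i` is the vertex set of a simplex whose relative interior contains 0
      (∀ i, AffineIndependent ℝ (fun v : Xs i => (v : EuclideanSpace ℝ (Fin n))) ∧
        ∃ μ : EuclideanSpace ℝ (Fin n) → ℝ,
          (∀ x ∈ Xs i, 0 < μ x) ∧ (∑ x ∈ Xs i, μ x = 1) ∧
          (∑ x ∈ Xs i, μ x • x = 0)) ∧
      -- (ii) the spans are linearly independent subspaces
      iSupIndep
        (fun i => Submodule.span ℝ ((Xs i : Set (EuclideanSpace ℝ (Fin n))))) ∧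
      -- (iii) they sum directly to `ℝⁿ`
      (⨆ i, Submodule.span ℝ ((Xs i : Set (EuclideanSpace ℝ (Fin n))))) = ⊤ := by
  classical
  let A : Set (Submodule ℝ (EuclideanSpace ℝ (Fin n))) :=
    {L | ∃ U f μ, GoodFam X U f μ ∧
      Submodule.span ℝ (U : Set (EuclideanSpace ℝ (Fin n))) = L}
  have hA : A.Nonempty := ⟨_, ∅, fun _ => 0, fun _ => 0,
    ⟨by simp, by simp, by simp, fun c _ => ⟨fun _ => 0, by simp⟩⟩, rfl⟩
  obtain ⟨L, ⟨U, f, μ, h, hL⟩, hmax⟩ := wellFounded_gt.has_min A hA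
  have htop : Submodule.span ℝ (U : Set (EuclideanSpace ℝ (Fin n))) = ⊤ := by
    by_contra hne
    obtain ⟨U', f', μ', h', hlt⟩ := h.step hspan h0 hcon hne
    exact hmax _ ⟨U', f', μ', h', rfl⟩ (hL ▸ hlt)
  let e := (U.image f).equivFin.symm
  have hne : ∀ i, (U.filter (fun x => f x = e i)).Nonempty := by
    intro i
    obtain ⟨x, hx, hxi⟩ := Finset.mem_image.1 (e i).2
    exact ⟨x, Finset.mem_filter.2 ⟨hx, hxi⟩⟩
  have hsp : ∀ i, 0 < ∑ x ∈ U with f x = e i, μ x := fun i =>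
    Finset.sum_pos (fun x hx => h.pos x (Finset.mem_filter.1 hx).1) (hne i)
  refine ⟨(U.image f).card, fun i => U.filter (fun x => f x = e i),
    fun i => (Finset.filter_subset _ _).trans h.sub, ?_, ?_, ?_, ?_⟩
  · intro i j hij
    refine Finset.disjoint_left.2 fun x hx hx' => hij ?_
    have := (Finset.mem_filter.1 hx).2.symm.trans (Finset.mem_filter.1 hx').2
    exact e.injective (Subtype.ext this)
  · intro i
    refine ⟨?_, fun x => (∑ x ∈ U with f x = e i, μ x)⁻¹ * μ x, ?_, ?_, ?_⟩
    · rw [affineIndependent_iff]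
      intro s w hw0 hw x hx
      let c : EuclideanSpace ℝ (Fin n) → ℝ := fun y =>
        if hy : y ∈ U.filter (fun x => f x = e i) then (if ⟨y, hy⟩ ∈ s then w ⟨y, hy⟩ else 0) else 0
      have hc : ∀ y : {y // y ∈ U.filter (fun x => f x = e i)}, c y = if y ∈ s then w y else 0 := by
        intro y
        simp only [c, y.2, dif_pos]
      have hcoff : ∀ y ∈ U, y ∉ U.filter (fun x => f x = e i) → c y = 0 := by
        intro y _ hy
        simp only [c, hy, dif_neg, not_false_eq_true]
      have h1 : ∑ y ∈ U with f y = e i, c y = 0 := by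
        rw [← Finset.sum_coe_sort, Finset.sum_congr rfl (fun y _ => hc y)]
        refine Eq.trans ?_ hw0
        rw [Finset.sum_ite_mem, Finset.univ_inter]
      have h2 : ∑ y ∈ U, c y • y = 0 := by
        rw [← Finset.sum_subset (Finset.filter_subset (fun x => f x = e i) U)
          (fun y hy hy' => by rw [hcoff y hy hy', zero_smul]), ← Finset.sum_coe_sort,
          Finset.sum_congr rfl (fun y _ => by rw [hc y])]
        refine Eq.trans ?_ hw
        simp only [ite_smul, zero_smul]
        rw [Finset.sum_ite_mem, Finset.univ_inter]
      obtain ⟨t, ht⟩ := h.uniq c h2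
      have h3 : t (e i) = 0 := by
        have : ∑ y ∈ U with f y = e i, c y = t (e i) * ∑ y ∈ U with f y = e i, μ y := by
          rw [Finset.mul_sum]
          refine Finset.sum_congr rfl fun y hy => ?_
          rw [ht y (Finset.mem_filter.1 hy).1, (Finset.mem_filter.1 hy).2]
        rw [h1] at this
        rcases mul_eq_zero.1 this.symm with h4 | h4
        · exact h4
        · exact absurd h4 (hsp i).ne'
      have h4 := ht x (Finset.mem_filter.1 x.2).1
      rw [(Finset.mem_filter.1 x.2).2, h3, zero_mul, hc x, if_pos hx] at h4
      exact h4
    · intro x hx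
      exact mul_pos (inv_pos.2 (hsp i)) (h.pos x (Finset.mem_filter.1 hx).1)
    · rw [← Finset.mul_sum, inv_mul_cancel₀ (hsp i).ne']
    · simp only [mul_smul, ← Finset.smul_sum, h.cls, smul_zero]
  · intro i
    have hle : (⨆ j, ⨆ (_ : j ≠ i), Submodule.span ℝ
        ((U.filter (fun x => f x = e j) : Finset _) : Set (EuclideanSpace ℝ (Fin n)))) ≤
        Submodule.span ℝ
        ((U.filter (fun x => ¬ f x = e i) : Finset _) : Set (EuclideanSpace ℝ (Fin n))) := by
      refine iSup₂_le fun j hj => Submodule.span_mono fun x hx => ?_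
      have hx' := Finset.mem_filter.1 (Finset.mem_coe.1 hx)
      refine Finset.mem_coe.2 (Finset.mem_filter.2 ⟨hx'.1, fun hxi => hj ?_⟩)
      exact e.injective (Subtype.ext (hx'.2.symm.trans hxi))
    refine Disjoint.mono_right hle ?_
    rw [Submodule.disjoint_def]
    intro x hx1 hx2
    obtain ⟨a, -, ha⟩ := Submodule.mem_span_finset.1 hx1
    obtain ⟨b, -, hb⟩ := Submodule.mem_span_finset.1 hx2
    have h1 : ∑ y ∈ U, (if f y = e i then a y else - b y) • y = 0 := by
      rw [← Finset.sum_filter_add_sum_filter_not U (fun y => f y = e i),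
        Finset.sum_congr rfl (fun y hy => by rw [if_pos (Finset.mem_filter.1 hy).2]), ha,
        Finset.sum_congr (s₁ := U.filter (fun y => ¬ f y = e i)) rfl
          (fun y hy => by rw [if_neg (Finset.mem_filter.1 hy).2, neg_smul]),
        Finset.sum_neg_distrib, hb, add_neg_cancel]
    obtain ⟨t, ht⟩ := h.uniq _ h1
    rw [← ha]
    have : ∑ y ∈ U with f y = e i, a y • y = t (e i) • ∑ y ∈ U with f y = e i, μ y • y := by
      rw [Finset.smul_sum]
      refine Finset.sum_congr rfl fun y hy => ?_
      have hy' := Finset.mem_filter.1 hy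
      have := ht y hy'.1
      rw [if_pos hy'.2, hy'.2] at this
      rw [this, mul_smul]
    rw [this, h.cls, smul_zero]
  · rw [eq_top_iff, ← htop]
    refine Submodule.span_le.2 fun x hx => ?_
    obtain ⟨i, hi⟩ := e.surjective ⟨f x, Finset.mem_image_of_mem f hx⟩
    refine Submodule.mem_iSup_of_mem i (Submodule.subset_span ?_)
    refine Finset.mem_coe.2 (Finset.mem_filter.2 ⟨hx, ?_⟩)
    rw [hi]
end
end

section
/- Every strongly monotypic polytope P ⊆ ℝⁿ can be illuminated by at most 2ⁿ directions: there exists a set V of at most 2ⁿ vectors such that for every x ∈ ∂P there is v ∈ V with x − v ∈ int P. -/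
open scoped RealInnerProductSpace
open Finset

noncomputable section

lemma exists_functional {ι V : Type*} [AddCommGroup V] [Module ℝ V] (f : ι → V) (s : Set ι)
    (hs : LinearIndepOn ℝ f s) (w : ι → ℝ) : ∃ φ : V →ₗ[ℝ] ℝ, ∀ i ∈ s, φ (f i) = w i := by
  have hs' : LinearIndependent ℝ (fun i : s => f i) := hs
  let b := Module.Basis.span hs'
  obtain ⟨φ, hφ⟩ := LinearMap.exists_extend (b.constr ℝ (fun i : s => w i))
  refine ⟨φ, fun i hi => ?_⟩
  have h1 : ((b ⟨i, hi⟩ : Submodule.span ℝ (Set.range (fun i : s => f i))) : V) = f i :=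
    congrArg Subtype.val (Module.Basis.span_apply hs' ⟨i, hi⟩)
  have h2 := congrArg (fun g => g (b ⟨i, hi⟩)) hφ
  simp only [LinearMap.comp_apply, Submodule.subtype_apply, Module.Basis.constr_basis] at h2
  rw [h1] at h2
  exact h2

lemma minrel {ι V : Type*} [Fintype ι] [AddCommGroup V] [Module ℝ V] (f : ι → V)
    (Rp Rn : ι → Prop) (a : ι) (c₀ : ι → ℝ) (h0 : ∑ i, c₀ i • f i = 0)
    (hp : ∀ i, 0 < c₀ i → Rp i) (hn : ∀ i, c₀ i < 0 → Rn i) (ha : 0 < c₀ a) :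
    ∃ c : ι → ℝ, ∑ i, c i • f i = 0 ∧ (∀ i, 0 < c i → Rp i) ∧ (∀ i, c i < 0 → Rn i) ∧ 0 < c a ∧
      ∀ e : ι → ℝ, ∑ i, e i • f i = 0 → (∀ i, c i = 0 → e i = 0) → ∃ r : ℝ, ∀ i, e i = r * c i := by
  classical
  let G : Set (ι → ℝ) := {c | ∑ i, c i • f i = 0 ∧ (∀ i, 0 < c i → Rp i) ∧
    (∀ i, c i < 0 → Rn i) ∧ 0 < c a}
  have hG : G.Nonempty := ⟨c₀, h0, hp, hn, ha⟩
  obtain ⟨c, hc, hmin⟩ : ∃ c ∈ G, ∀ d ∈ G,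
      (Finset.univ.filter (fun i => c i ≠ 0)).card ≤ (Finset.univ.filter (fun i => d i ≠ 0)).card := by
    let g : (ι → ℝ) → ℕ := fun c => (Finset.univ.filter (fun i => c i ≠ 0)).card
    exact ⟨Function.argminOn g G hG, Function.argminOn_mem _ G hG,
      fun d hd => Function.argminOn_le g G hd⟩
  obtain ⟨hc0, hcp, hcn, hca⟩ := hc
  -- relations vanishing at `a` that can be subtracted are impossible
  have key : ∀ e : ι → ℝ, ∑ i, e i • f i = 0 → (∀ i, c i = 0 → e i = 0) → e a = 0 →
      ∀ i, ¬ (0 < e i * c i) := by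
    intro e he hs hea i hi
    let M := Finset.univ.filter (fun i => 0 < e i * c i)
    obtain ⟨j, hjM, hj⟩ := Finset.exists_min_image M (fun i => c i / e i) ⟨i, by simp [M, hi]⟩
    have hj1 : 0 < e j * c j := by simpa [M] using hjM
    have hej : e j ≠ 0 := by rintro h; simp [h] at hj1
    have hcj : c j ≠ 0 := by rintro h; simp [h] at hj1
    set t := c j / e j with ht
    have htpos : 0 < t := by
      have : t = (e j * c j) / (e j)^2 := by rw [ht]; field_simp
      rw [this]; positivity
    have hsign : ∀ k, (0 < c k - t * e k → 0 < c k) ∧ (c k - t * e k < 0 → c k < 0) := by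
      intro k
      rcases lt_trichotomy (c k) 0 with hk | hk | hk
      · refine ⟨fun hh => ?_, fun _ => hk⟩
        exfalso
        have hek : e k < 0 := by nlinarith
        have := hj k (by simp [M]; nlinarith)
        rw [le_div_iff_of_neg hek] at this
        linarith
      · rw [hk, hs k hk]; simp
      · refine ⟨fun _ => hk, fun hh => ?_⟩
        exfalso
        have hek : 0 < e k := by nlinarith
        have := hj k (by simp [M]; nlinarith)
        rw [le_div_iff₀ hek] at this
        linarith
    have hd : (fun k => c k - t * e k) ∈ G := by
      refine ⟨?_, fun k hk => hcp k ((hsign k).1 hk), fun k hk => hcn k ((hsign k).2 hk), ?_⟩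
      · simp only [sub_smul, Finset.sum_sub_distrib, hc0, mul_smul, ← Finset.smul_sum, he]; simp
      · simp [hea, hca]
    have h1 := hmin _ hd
    have h2 : (Finset.univ.filter (fun k => c k - t * e k ≠ 0)).card <
        (Finset.univ.filter (fun k => c k ≠ 0)).card := by
      apply Finset.card_lt_card
      rw [Finset.ssubset_iff_of_subset]
      · refine ⟨j, by simpa using hcj, ?_⟩
        simp [ht, hej]
      · intro k hk
        simp only [Finset.mem_filter, Finset.mem_univ, true_and] at hk ⊢
        intro h
        apply hk; rw [h, hs k h]; simp
    omega
  refine ⟨c, hc0, hcp, hcn, hca, fun e he hs => ⟨e a / c a, fun i => ?_⟩⟩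
  by_contra hne
  let e' : ι → ℝ := fun i => e i - (e a / c a) * c i
  have he' : ∑ i, e' i • f i = 0 := by
    simp only [e', sub_smul, Finset.sum_sub_distrib, hc0, mul_smul, ← Finset.smul_sum, he]; simp
  have hs' : ∀ i, c i = 0 → e' i = 0 := by
    intro i hi; simp [e', hi, hs i hi]
  have hea' : e' a = 0 := by simp [e']; field_simp; simp
  have hi' : e' i ≠ 0 := by simpa [e', sub_eq_zero] using hne
  have hci : c i ≠ 0 := fun h => hi' (hs' i h)
  have hprod : e' i * c i ≠ 0 := mul_ne_zero hi' hci
  rcases lt_or_gt_of_ne hprod with h | h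
  · refine key (fun k => - e' k) (by simp [he']) (fun k hk => by simp [hs' k hk]) (by simp [hea']) i ?_
    simpa using h
  · exact key e' he' hs' hea' i h

lemma indep_of_unique {ι V : Type*} [Fintype ι] [AddCommGroup V] [Module ℝ V] (f : ι → V)
    (a : ι) (c : ι → ℝ) (ha : c a ≠ 0)
    (hu : ∀ e : ι → ℝ, ∑ i, e i • f i = 0 → (∀ i, c i = 0 → e i = 0) → ∃ r : ℝ, ∀ i, e i = r * c i) :
    LinearIndepOn ℝ f {i | c i ≠ 0 ∧ i ≠ a} := by
  classical
  rw [linearIndepOn_iff]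
  intro l hl h0
  rw [Finsupp.mem_supported] at hl
  have h1 : ∑ i, l i • f i = 0 := by
    rw [Finsupp.linearCombination_apply, Finsupp.sum_fintype _ _ (by simp)] at h0
    exact h0
  have hz : ∀ i, ¬ (c i ≠ 0 ∧ i ≠ a) → l i = 0 := by
    intro i hi
    by_contra hne
    exact hi (hl (by simpa using hne))
  obtain ⟨r, hr⟩ := hu l h1 (fun i hi => hz i (by simp [hi]))
  have : r = 0 := by
    have h2 := hr a
    rw [hz a (by simp)] at h2
    rcases mul_eq_zero.1 h2.symm with h | h
    · exact h
    · exact absurd h ha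
  ext i; simp [hr i, this]

lemma cover_aux {ι : Type*} [Fintype ι] (n : ℕ) : ∀ (V : Type) [AddCommGroup V] [Module ℝ V]
    [FiniteDimensional ℝ V] (_ : Module.finrank ℝ V = n) (f : ι → V)
    (_ : ∀ z : V, ∃ c : ι → ℝ, (∀ i, 0 ≤ c i) ∧ ∑ i, c i • f i = z),
    ∃ F : Finset (Finset ι), F.card ≤ 2 ^ n ∧
      (∀ Y ∈ F, ∃ φ : V →ₗ[ℝ] ℝ, ∀ i ∈ Y, 0 < φ (f i)) ∧
      ∀ z : V, ∃ Y ∈ F, ∃ c : ι → ℝ, (∀ i, 0 ≤ c i) ∧ (∀ i, i ∉ Y → c i = 0) ∧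
        ∑ i, c i • f i = z := by
  classical
  induction n using Nat.strong_induction_on with
  | _ n ih =>
  intro V _ _ _ hn f hf
  rcases Nat.eq_zero_or_pos n with h0 | hpos
  · refine ⟨{∅}, by simp [h0], by simp, fun z => ⟨∅, by simp, 0, by simp, by simp, ?_⟩⟩
    have := Module.finrank_zero_iff.1 (hn.trans h0)
    exact Subsingleton.elim _ _
  have hnt : Nontrivial V := Module.finrank_pos_iff.1 (hn ▸ hpos)
  obtain ⟨a, ha⟩ : ∃ a, f a ≠ 0 := by
    by_contra! hall
    obtain ⟨z, hz⟩ := exists_ne (0 : V)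
    obtain ⟨c, -, hc⟩ := hf z
    apply hz; rw [← hc]; simp [hall]
  obtain ⟨c₁, hc₁, hs₁⟩ := hf (- f a)
  obtain ⟨c, hc0, -, hcn, hca, hu⟩ := minrel f (fun _ => True) (fun _ => False) a
    (fun i => c₁ i + if i = a then 1 else 0)
    (by simp [add_smul, Finset.sum_add_distrib, hs₁]) (by simp)
    (fun i hi => by
      have := hc₁ i
      split_ifs at hi <;> linarith)
    (by have := hc₁ a; simp; linarith)
  have hcnn : ∀ i, 0 ≤ c i := fun i => not_lt.1 (hcn i)
  let X : Finset ι := Finset.univ.filter (fun i => c i ≠ 0)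
  have haX : a ∈ X := by simp [X, hca.ne']
  have hXpos : ∀ i ∈ X, 0 < c i := fun i hi =>
    lt_of_le_of_ne (hcnn i) (Ne.symm (by simpa [X] using hi))
  have hind : ∀ x ∈ X, LinearIndepOn ℝ f ((X.erase x : Finset ι) : Set ι) := by
    intro x hx
    have := indep_of_unique f x c (hXpos x hx).ne' hu
    convert this using 1
    ext i; simp [X, and_comm]
  let L : Submodule ℝ V := Submodule.span ℝ (f '' (X : Set ι))
  have hfL : ∀ i ∈ X, f i ∈ L := fun i hi => Submodule.subset_span ⟨i, hi, rfl⟩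
  have hLrank : X.card ≤ Module.finrank ℝ L + 1 := by
    have h1 : LinearIndependent ℝ (fun i : (X.erase a : Finset ι) =>
        (⟨f i, hfL i (Finset.mem_of_mem_erase i.2)⟩ : L)) := by
      apply LinearIndependent.of_comp L.subtype
      exact hind a haX
    have h2 := h1.fintype_card_le_finrank
    rw [Fintype.card_coe, Finset.card_erase_of_mem haX] at h2
    omega
  have hLpos : 0 < Module.finrank ℝ L := by
    have : Nontrivial L := ⟨⟨⟨f a, hfL a haX⟩, 0, by simpa [Subtype.ext_iff] using ha⟩⟩
    exact Module.finrank_pos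
  have hq := L.finrank_quotient_add_finrank
  obtain ⟨F, hFc, hFφ, hFcov⟩ := ih (Module.finrank ℝ (V ⧸ L)) (by omega) (V ⧸ L) rfl
    (fun i => L.mkQ (f i)) (by
      intro z
      obtain ⟨w, rfl⟩ := L.mkQ_surjective z
      obtain ⟨d, hd, hs⟩ := hf w
      exact ⟨d, hd, by rw [← hs]; simp⟩)
  refine ⟨(F ×ˢ X).image (fun p => p.1 ∪ X.erase p.2), ?_, ?_, ?_⟩
  · refine Finset.card_image_le.trans ?_
    rw [Finset.card_product]
    have h1 : X.card ≤ 2 ^ Module.finrank ℝ L := hLrank.trans Nat.lt_two_pow_self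
    calc F.card * X.card ≤ 2 ^ Module.finrank ℝ (V ⧸ L) * 2 ^ Module.finrank ℝ L :=
          Nat.mul_le_mul hFc h1
      _ = 2 ^ n := by rw [← pow_add, hq, hn]
  · intro Y' hY'
    simp only [Finset.mem_image, Finset.mem_product, Prod.exists] at hY'
    obtain ⟨Y, x, ⟨hY, hx⟩, rfl⟩ := hY'
    obtain ⟨φ, hφ⟩ := hFφ Y hY
    obtain ⟨ψ, hψ⟩ := exists_functional f _ (hind x hx) (fun _ => 1)
    let K : ℝ := ∑ i ∈ Y, |ψ (f i)| / φ (L.mkQ (f i)) + 1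
    refine ⟨ψ + K • (φ ∘ₗ L.mkQ), fun i hi => ?_⟩
    have hval : (ψ + K • (φ ∘ₗ L.mkQ)) (f i) = ψ (f i) + K * φ (L.mkQ (f i)) := by simp
    rw [hval]
    by_cases hiY : i ∈ Y
    · have h1 := hφ i hiY
      have h2 : |ψ (f i)| / φ (L.mkQ (f i)) ≤ ∑ i ∈ Y, |ψ (f i)| / φ (L.mkQ (f i)) :=
        Finset.single_le_sum (f := fun i => |ψ (f i)| / φ (L.mkQ (f i)))
          (fun j hj => div_nonneg (abs_nonneg _) (hφ j hj).le) hiY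
      have h3 : |ψ (f i)| / φ (L.mkQ (f i)) < K := lt_of_le_of_lt h2 (by simp [K])
      rw [div_lt_iff₀ h1] at h3
      have := neg_abs_le (ψ (f i))
      linarith
    · have hiX : i ∈ X.erase x := by
        rcases Finset.mem_union.1 hi with h | h
        · exact absurd h hiY
        · exact h
      have h1 : L.mkQ (f i) = 0 := by
        rw [Submodule.mkQ_apply, Submodule.Quotient.mk_eq_zero]
        exact hfL i (Finset.mem_of_mem_erase hiX)
      rw [h1, hψ i hiX]; simp
  · intro z
    obtain ⟨Y, hY, d, hd, hdY, hs⟩ := hFcov (L.mkQ z)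
    have hzL : z - ∑ i, d i • f i ∈ L := by
      rw [← Submodule.Quotient.mk_eq_zero, ← Submodule.mkQ_apply, map_sub, ← hs]
      simp
    obtain ⟨g, hg⟩ : ∃ g : ι → ℝ, ∑ i ∈ X, g i • f i = z - ∑ i, d i • f i := by
      obtain ⟨g, hg⟩ := (Submodule.mem_span_image_finset_iff_exists_fun ℝ).1 hzL
      refine ⟨fun i => if h : i ∈ X then g ⟨i, h⟩ else 0, ?_⟩
      rw [← hg, ← Finset.sum_coe_sort X]
      exact Finset.sum_congr rfl (fun i _ => by simp)
    obtain ⟨x, hx, hmin⟩ := Finset.exists_min_image X (fun i => g i / c i) ⟨a, haX⟩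
    let t := g x / c x
    have hgt : ∀ i ∈ X, 0 ≤ g i - t * c i := by
      intro i hi
      have := hmin i hi
      rw [le_div_iff₀ (hXpos i hi)] at this
      simp only [t]; linarith
    have hgx : g x - t * c x = 0 := by
      have := (hXpos x hx).ne'
      simp only [t]; field_simp; simp
    refine ⟨Y ∪ X.erase x, Finset.mem_image.2 ⟨(Y, x), by simp [hY, hx], rfl⟩,
      fun i => d i + if i ∈ X then g i - t * c i else 0, ?_, ?_, ?_⟩
    · intro i
      have := hd i
      dsimp only
      split_ifs with h
      · have := hgt i h; linarith
      · linarith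
    · intro i hi
      simp only [Finset.mem_union, Finset.mem_erase, not_or, not_and] at hi
      dsimp only
      rw [hdY i hi.1]
      split_ifs with h
      · have : i = x := by by_contra h'; exact hi.2 h' h
        rw [this, hgx]; simp
      · simp
    · have h1 : ∑ i ∈ X, c i • f i = 0 := by
        rw [← hc0]
        apply Finset.sum_subset (Finset.subset_univ _)
        intro i _ hi
        have : c i = 0 := by simpa [X] using hi
        simp [this]
      simp only [add_smul, Finset.sum_add_distrib, ite_smul, zero_smul, Finset.sum_ite_mem,
        Finset.univ_inter, sub_smul, Finset.sum_sub_distrib, mul_smul, ← Finset.smul_sum, h1, hg]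
      simp

lemma posHull_of_fun {E : Type*} [AddCommGroup E] [Module ℝ E] (N : Finset E) (V : Set E)
    (g : {m // m ∈ N} → ℝ) (hg : ∀ i, 0 ≤ g i) (hV : ∀ i, g i ≠ 0 → (i : E) ∈ V) (z : E)
    (hz : ∑ i, g i • (i : E) = z) : z ∈ posHull V := by
  classical
  refine ⟨(Finset.univ.filter (fun i => g i ≠ 0)).map ⟨Subtype.val, Subtype.val_injective⟩,
    fun x => if h : x ∈ N then g ⟨x, h⟩ else 0, ?_, ?_, ?_⟩
  · intro x hx
    simp only [Finset.coe_map, Function.Embedding.coeFn_mk, Set.mem_image, Finset.mem_coe,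
      Finset.mem_filter, Finset.mem_univ, true_and] at hx
    obtain ⟨i, hi, rfl⟩ := hx
    exact hV i hi
  · intro x _
    dsimp only
    split_ifs
    · exact hg _
    · exact le_rfl
  · rw [Finset.sum_map, ← hz]
    rw [Finset.sum_filter]
    refine Finset.sum_congr rfl (fun i _ => ?_)
    by_cases h : g i = 0 <;> simp [h]

lemma fun_of_posHull {E : Type*} [AddCommGroup E] [Module ℝ E] (N : Finset E) (V : Set E)
    (hVN : V ⊆ N) (z : E) (hz : z ∈ posHull V) :
    ∃ g : {m // m ∈ N} → ℝ, (∀ i, 0 ≤ g i) ∧ (∀ i, g i ≠ 0 → (i : E) ∈ V) ∧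
      ∑ i, g i • (i : E) = z := by
  classical
  obtain ⟨t, c, ht, hc, rfl⟩ := hz
  refine ⟨fun i => if (i : E) ∈ t then c i else 0, ?_, ?_, ?_⟩
  · intro i
    dsimp only
    split_ifs with h
    · exact hc _ h
    · exact le_rfl
  · intro i hi
    by_contra h
    apply hi
    simp only [ite_eq_right_iff]
    intro h'
    exact absurd (ht h') h
  · rw [Finset.sum_coe_sort N (fun x : E => (if x ∈ t then c x else 0) • x)]
    simp only [ite_smul, zero_smul, Finset.sum_ite_mem]
    have : N ∩ t = t := Finset.inter_eq_right.2 (fun x hx => hVN (ht hx))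
    rw [this]

lemma posHull_mono {E : Type*} [AddCommGroup E] [Module ℝ E] {V W : Set E} (h : V ⊆ W) :
    posHull V ⊆ posHull W := by
  rintro z ⟨t, c, ht, hc, hz⟩
  exact ⟨t, c, ht.trans h, hc, hz⟩

lemma conical_mono {n : ℕ} {S T : Set (EuclideanSpace ℝ (Fin n))} (h : S ⊆ T)
    (hT : InConicalPos T) : InConicalPos S := by
  obtain ⟨⟨v, hv⟩, h2⟩ := hT
  exact ⟨⟨v, fun s hs => hv s (h hs)⟩, fun s hs hm =>
    h2 s (h hs) (posHull_mono (Set.sdiff_subset_sdiff_left h) hm)⟩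

lemma exists_vec {n : ℕ} (φ : EuclideanSpace ℝ (Fin n) →ₗ[ℝ] ℝ) :
    ∃ v : EuclideanSpace ℝ (Fin n), ∀ x, ⟪v, x⟫ = φ x := by
  refine ⟨(InnerProductSpace.toDual ℝ _).symm (LinearMap.toContinuousLinearMap φ), fun x => ?_⟩
  rw [InnerProductSpace.toDual_symm_apply]
  rfl

lemma conical_insert {n : ℕ} {S : Set (EuclideanSpace ℝ (Fin n))} (hS : InConicalPos S)
    (m : EuclideanSpace ℝ (Fin n)) (hm : m ∉ Submodule.span ℝ S) : InConicalPos (insert m S) := by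
  classical
  obtain ⟨⟨v, hv⟩, h2⟩ := hS
  obtain ⟨g, hgm, hg⟩ := Submodule.exists_le_ker_of_notMem hm
  have hgS : ∀ s ∈ S, g s = 0 := fun s hs => hg (Submodule.subset_span hs)
  obtain ⟨w, hw⟩ := exists_vec g
  refine ⟨⟨v + ((1 - ⟪v, m⟫) / g m) • w, ?_⟩, ?_⟩
  · rintro s (rfl | hs)
    · rw [inner_add_left, real_inner_smul_left, hw]
      field_simp; simp
    · rw [inner_add_left, real_inner_smul_left, hw, hgS s hs]
      simpa using hv s hs
  · rintro s (rfl | hs) ⟨t, c, ht, hc, hz⟩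
    · apply hm
      rw [← hz]
      refine Submodule.sum_mem _ (fun z hz => Submodule.smul_mem _ _ (Submodule.subset_span ?_))
      have := ht hz
      simp only [Set.mem_sdiff, Set.mem_insert_iff, Set.mem_singleton_iff] at this
      tauto
    · refine h2 s hs ⟨t.erase m, c, ?_, fun z hz => hc z (Finset.mem_of_mem_erase hz), ?_⟩
      · intro z hz
        rw [Finset.mem_coe, Finset.mem_erase] at hz
        have := ht hz.2
        simp only [Set.mem_sdiff, Set.mem_insert_iff, Set.mem_singleton_iff] at this ⊢
        tauto
      · by_cases hmt : m ∈ t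
        · rw [← Finset.add_sum_erase _ _ hmt] at hz
          have h3 := congrArg g hz
          rw [map_add, map_sum, hgS s hs, Finset.sum_eq_zero, map_smul, add_zero, smul_eq_mul] at h3
          · have h4 : c m = 0 := by
              rcases mul_eq_zero.1 h3 with h | h
              · exact h
              · exact absurd h hgm
            rw [h4] at hz; simpa using hz
          · intro z hz
            rw [Finset.mem_erase] at hz
            have := ht hz.2
            simp only [Set.mem_sdiff, Set.mem_insert_iff, Set.mem_singleton_iff] at this
            rw [map_smul, hgS z (by tauto), smul_zero]
        · rwa [Finset.erase_eq_of_notMem hmt]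

lemma indep_of_conical {n : ℕ} (N : Finset (EuclideanSpace ℝ (Fin n)))
    (hspan : Submodule.span ℝ (N : Set (EuclideanSpace ℝ (Fin n))) = ⊤)
    (hmono : ∀ S : Finset (EuclideanSpace ℝ (Fin n)),
      S ⊆ N → S.card = n + 1 → ¬ InConicalPos (S : Set (EuclideanSpace ℝ (Fin n))))
    (S : Finset (EuclideanSpace ℝ (Fin n))) (hSN : S ⊆ N)
    (hS : InConicalPos (S : Set (EuclideanSpace ℝ (Fin n)))) :
    LinearIndepOn ℝ id (S : Set (EuclideanSpace ℝ (Fin n))) := by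
  classical
  let Q := N.powerset.filter (fun T => S ⊆ T ∧ InConicalPos (T : Set (EuclideanSpace ℝ (Fin n))))
  obtain ⟨T, hTQ, hTmax⟩ := Finset.exists_max_image Q Finset.card
    ⟨S, by simp [Q, hSN, hS]⟩
  simp only [Q, Finset.mem_filter, Finset.mem_powerset] at hTQ hTmax
  obtain ⟨hTN, hST, hT⟩ := hTQ
  have hTspan : Submodule.span ℝ (T : Set (EuclideanSpace ℝ (Fin n))) = ⊤ := by
    rw [eq_top_iff, ← hspan, Submodule.span_le]
    intro m hm
    by_contra hmT
    have hmT' : m ∉ T := fun h => hmT (Submodule.subset_span h)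
    have := hTmax (insert m T) ⟨Finset.insert_subset hm hTN, hST.trans (Finset.subset_insert _ _), by
      rw [Finset.coe_insert]; exact conical_insert hT m hmT⟩
    rw [Finset.card_insert_of_notMem hmT'] at this
    omega
  have hcard : T.card ≤ n := by
    by_contra! h
    obtain ⟨U, hUT, hU⟩ := Finset.exists_subset_card_eq (show n + 1 ≤ T.card from h)
    exact hmono U (hUT.trans hTN) hU (conical_mono (by exact_mod_cast hUT) hT)
  have : LinearIndependent ℝ (fun x : {x // x ∈ T} => (x : EuclideanSpace ℝ (Fin n))) := by
    apply linearIndependent_of_top_le_span_of_card_le_finrank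
    · rw [Subtype.range_coe_subtype]
      exact hTspan.ge
    · simpa using hcard
  have hTI : LinearIndepOn ℝ id (T : Set (EuclideanSpace ℝ (Fin n))) := this
  exact hTI.mono (by exact_mod_cast hST)

lemma local_dir {n : ℕ} (N : Finset (EuclideanSpace ℝ (Fin n)))
    (hI : ∀ S : Finset (EuclideanSpace ℝ (Fin n)), S ⊆ N →
      InConicalPos (S : Set (EuclideanSpace ℝ (Fin n))) →
      LinearIndepOn ℝ id (S : Set (EuclideanSpace ℝ (Fin n))))
    (A : Finset (EuclideanSpace ℝ (Fin n))) (hAN : A ⊆ N)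
    (u : EuclideanSpace ℝ (Fin n)) (hu : ∀ a ∈ A, 0 < ⟪u, a⟫)
    (hstar : ∀ m ∈ N, m ∉ posHull ((A : Set (EuclideanSpace ℝ (Fin n))) \ {m}))
    (Y : Finset {m // m ∈ N}) (v : EuclideanSpace ℝ (Fin n))
    (hv : ∀ y ∈ Y, 0 < ⟪v, (y : EuclideanSpace ℝ (Fin n))⟫)
    (d : {m // m ∈ N} → ℝ) (hd : ∀ i, 0 ≤ d i) (hdY : ∀ i, i ∉ Y → d i = 0)
    (hs : ∑ i, d i • (i : EuclideanSpace ℝ (Fin n)) = ∑ a ∈ A, a) :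
    ∀ a ∈ A, 0 < ⟪v, a⟫ := by
  classical
  intro a₀ ha₀
  by_contra! hneg
  let a : {m // m ∈ N} := ⟨a₀, hAN ha₀⟩
  have haY : a ∉ Y := fun h => absurd (hv a h) (not_lt.2 hneg)
  obtain ⟨c, hc0, hcp, hcn, hca, huniq⟩ := minrel
    (fun i : {m // m ∈ N} => (i : EuclideanSpace ℝ (Fin n)))
    (fun i => (i : EuclideanSpace ℝ (Fin n)) ∈ A) (fun i => i ∈ Y) a
    (fun i => (if (i : EuclideanSpace ℝ (Fin n)) ∈ A then 1 else 0) - d i)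
    (by
      simp only [sub_smul, Finset.sum_sub_distrib, hs]
      rw [Finset.sum_coe_sort N (fun x : EuclideanSpace ℝ (Fin n) =>
        (if x ∈ A then (1 : ℝ) else 0) • x)]
      simp only [ite_smul, zero_smul, one_smul, Finset.sum_ite_mem]
      rw [Finset.inter_eq_right.2 hAN, sub_self])
    (fun i hi => by
      by_contra h
      have := hd i
      rw [if_neg h] at hi
      linarith)
    (fun i hi => by
      by_contra h
      rw [hdY i h] at hi
      split_ifs at hi <;> linarith)
    (by rw [if_pos (show (a : EuclideanSpace ℝ (Fin n)) ∈ A from ha₀), hdY a haY]; norm_num)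
  have hinner : ∀ w : EuclideanSpace ℝ (Fin n),
      ∑ i, c i * ⟪w, (i : EuclideanSpace ℝ (Fin n))⟫ = 0 := by
    intro w
    have := congrArg (fun z => ⟪w, z⟫) hc0
    simpa [inner_sum, real_inner_smul_right] using this
  -- there is a negative coefficient
  obtain ⟨y, hy⟩ : ∃ y, c y < 0 := by
    by_contra! hall
    have : 0 < ∑ i, c i * ⟪u, (i : EuclideanSpace ℝ (Fin n))⟫ := by
      apply Finset.sum_pos'
      · intro i _
        rcases (hall i).eq_or_lt with h | h
        · rw [← h]; simp
        · exact (mul_pos h (hu _ (hcp i h))).le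
      · exact ⟨a, Finset.mem_univ _, mul_pos hca (hu _ ha₀)⟩
    exact absurd (hinner u) this.ne'
  obtain ⟨y₂, hy₂, hyne⟩ : ∃ y₂, c y₂ < 0 ∧ y₂ ≠ y := by
    by_contra! hall
    refine hstar y y.2 (posHull_of_fun N _ (fun i => if i = y then 0 else c i / (- c y)) ?_ ?_ _ ?_)
    · intro i
      split_ifs with h
      · exact le_rfl
      · exact div_nonneg (not_lt.1 (fun h' => h (hall i h'))) (by linarith)
    · intro i hi
      have hiy : i ≠ y := by rintro rfl; simp at hi
      rw [if_neg hiy] at hi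
      have h1 : 0 ≤ c i := not_lt.1 (fun h' => hiy (hall i h'))
      have h2 : c i ≠ 0 := by rintro h; simp [h] at hi
      refine ⟨hcp i (lt_of_le_of_ne h1 h2.symm), ?_⟩
      exact fun h => hiy (Subtype.ext h)
    · have h1 : ∀ i : {m // m ∈ N}, (if i = y then 0 else c i / (- c y)) =
          (- c y)⁻¹ * c i + if i = y then 1 else 0 := by
        intro i
        have := hy.ne
        split_ifs with h
        · subst h; field_simp; simp
        · rw [add_zero, div_eq_inv_mul]
      simp only [h1, add_smul, Finset.sum_add_distrib, mul_smul, ← Finset.smul_sum, hc0]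
      simp
  -- a second positive coefficient
  obtain ⟨p, hp, hpne⟩ : ∃ p, 0 < c p ∧ p ≠ a := by
    by_contra! hall
    have hle : ∀ i, c i * ⟪v, (i : EuclideanSpace ℝ (Fin n))⟫ ≤ 0 := by
      intro i
      rcases lt_trichotomy (c i) 0 with h | h | h
      · exact (mul_neg_of_neg_of_pos h (hv i (hcn i h))).le
      · rw [h]; simp
      · rw [hall i h]
        exact mul_nonpos_of_nonneg_of_nonpos hca.le hneg
    have : ∑ i, c i * ⟪v, (i : EuclideanSpace ℝ (Fin n))⟫ < 0 :=
      Finset.sum_neg' (fun i _ => hle i)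
        ⟨y, Finset.mem_univ _, mul_neg_of_neg_of_pos hy (hv y (hcn y hy))⟩
    exact absurd (hinner v) this.ne
  let S : Finset (EuclideanSpace ℝ (Fin n)) :=
    (Finset.univ.filter (fun i => c i ≠ 0)).map ⟨Subtype.val, Subtype.val_injective⟩
  have hSmem : ∀ s, s ∈ S ↔ ∃ i : {m // m ∈ N}, c i ≠ 0 ∧ (i : EuclideanSpace ℝ (Fin n)) = s := by
    intro s; simp [S]
  have hSN : S ⊆ N := by
    intro s hs
    obtain ⟨i, -, rfl⟩ := (hSmem s).1 hs
    exact i.2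
  have hcon : InConicalPos (S : Set (EuclideanSpace ℝ (Fin n))) := by
    constructor
    · let Tp : ℝ := ∑ i, if 0 < c i then c i else 0
      let Tn : ℝ := ∑ i, if c i < 0 then - c i else 0
      have hTp : 0 < Tp := by
        apply Finset.sum_pos'
        · intro i _
          split_ifs with h
          · exact h.le
          · exact le_rfl
        · exact ⟨a, Finset.mem_univ _, by rw [if_pos hca]; exact hca⟩
      have hTn : 0 < Tn := by
        apply Finset.sum_pos'
        · intro i _
          split_ifs with h
          · linarith
          · exact le_rfl
        · exact ⟨y, Finset.mem_univ _, by rw [if_pos hy]; linarith⟩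
      let w : {m // m ∈ N} → ℝ := fun i => if 0 < c i then Tn else Tp
      have hw : ∀ i, 0 < w i := by
        intro i
        simp only [w]
        split_ifs <;> assumption
      have hcw : ∑ i, c i * w i = 0 := by
        have h1 : ∀ i, c i * w i = Tn * (if 0 < c i then c i else 0)
            - Tp * (if c i < 0 then - c i else 0) := by
          intro i
          simp only [w]
          rcases lt_trichotomy (c i) 0 with h | h | h
          · simp [h, h.not_gt]; ring
          · simp [h]
          · simp [h, h.not_gt]; ring
        simp only [h1, Finset.sum_sub_distrib, ← Finset.mul_sum]
        change Tn * Tp - Tp * Tn = 0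
        ring
      obtain ⟨φ, hφ⟩ := exists_functional
        (fun i : {m // m ∈ N} => (i : EuclideanSpace ℝ (Fin n))) _
        (indep_of_unique _ a c hca.ne' huniq) w
      have hφ0 : ∑ i, c i * φ (i : EuclideanSpace ℝ (Fin n)) = 0 := by
        have := congrArg φ hc0
        simpa using this
      have hφa : φ (a : EuclideanSpace ℝ (Fin n)) = w a := by
        have h1 : ∑ i, c i * (φ (i : EuclideanSpace ℝ (Fin n)) - w i) = 0 := by
          simp only [mul_sub, Finset.sum_sub_distrib, hφ0, hcw, sub_zero]
        rw [Finset.sum_eq_single a] at h1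
        · rcases mul_eq_zero.1 h1 with h | h
          · exact absurd h hca.ne'
          · linarith
        · intro i _ hi
          by_cases h : c i = 0
          · rw [h, zero_mul]
          · rw [hφ i ⟨h, hi⟩]; simp
        · simp
      obtain ⟨q, hq⟩ := exists_vec φ
      refine ⟨q, fun s hs => ?_⟩
      obtain ⟨i, hi, rfl⟩ := (hSmem s).1 hs
      rw [hq]
      by_cases h : i = a
      · rw [h, hφa]; exact hw a
      · rw [hφ i ⟨hi, h⟩]; exact hw i
    · intro s hs hmem
      obtain ⟨j, hj, rfl⟩ := (hSmem s).1 hs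
      obtain ⟨g, hg, hgV, hgs⟩ := fun_of_posHull N _
        (Set.sdiff_subset.trans (by exact_mod_cast hSN)) _ hmem
      have hgj : g j = 0 := by
        by_contra h
        exact (hgV j h).2 rfl
      obtain ⟨r, hr⟩ := huniq (fun i => (if i = j then 1 else 0) - g i)
        (by simp only [sub_smul, Finset.sum_sub_distrib, hgs, ite_smul, one_smul, zero_smul,
          Finset.sum_ite_eq', Finset.mem_univ, if_true, sub_self])
        (fun i hi => by
          have hij : i ≠ j := by rintro rfl; exact hj hi
          rw [if_neg hij, zero_sub, neg_eq_zero]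
          by_contra h
          obtain ⟨k, hk, hki⟩ := (hSmem _).1 (hgV i h).1
          rw [Subtype.ext hki] at hk
          exact hk hi)
      have hrj := hr j
      rw [if_pos rfl, hgj, sub_zero] at hrj
      have hother : ∀ k, k ≠ j → 0 < r * c k → False := by
        intro k hk h
        have := hr k
        rw [if_neg hk] at this
        have := hg k
        linarith
      rcases lt_or_gt_of_ne hj with h | h
      · have hrn : r < 0 := by nlinarith
        by_cases hyj : y = j
        · exact hother y₂ (hyj ▸ hyne) (mul_pos_of_neg_of_neg hrn hy₂)
        · exact hother y hyj (mul_pos_of_neg_of_neg hrn hy)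
      · have hrp : 0 < r := by nlinarith
        by_cases haj : a = j
        · exact hother p (haj ▸ hpne) (mul_pos hrp hp)
        · exact hother a haj (mul_pos hrp hca)
  have hli := hI S hSN hcon
  rw [linearIndepOn_finset_iff] at hli
  have h1 := hli (fun x => if h : x ∈ N then c ⟨x, h⟩ else 0) (by
    rw [← hc0, Finset.sum_map, Finset.sum_filter]
    refine Finset.sum_congr rfl (fun i _ => ?_)
    by_cases h : c i = 0 <;> simp [h]) a ((hSmem _).2 ⟨a, hca.ne', rfl⟩)
  rw [dif_pos a.2] at h1
  exact hca.ne' h1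

lemma pos_span {n : ℕ} (N : Finset (EuclideanSpace ℝ (Fin n)))
    (h : EuclideanSpace ℝ (Fin n) → ℝ) (P : Set (EuclideanSpace ℝ (Fin n)))
    (hP : P = {p | ∀ m ∈ N, ⟪m, p⟫ ≤ h m}) (hcomp : IsCompact P) (hne : P.Nonempty)
    (z : EuclideanSpace ℝ (Fin n)) :
    ∃ c : {m // m ∈ N} → ℝ, (∀ i, 0 ≤ c i) ∧ ∑ i, c i • (i : EuclideanSpace ℝ (Fin n)) = z := by
  classical
  let K : Set (EuclideanSpace ℝ (Fin n)) := {z | ∃ c : {m // m ∈ N} → ℝ, (∀ i, 0 ≤ c i) ∧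
    ∑ i, c i • (i : EuclideanSpace ℝ (Fin n)) = z}
  have hKconv : Convex ℝ K := by
    rintro x ⟨c, hc, rfl⟩ y ⟨d, hd, rfl⟩ s t hs ht -
    refine ⟨fun i => s * c i + t * d i, fun i => ?_, ?_⟩
    · exact add_nonneg (mul_nonneg hs (hc i)) (mul_nonneg ht (hd i))
    · simp only [add_smul, Finset.sum_add_distrib, mul_smul, Finset.smul_sum]
  have hmem : ∀ i : {m // m ∈ N}, ∀ t : ℝ, 0 ≤ t → t • (i : EuclideanSpace ℝ (Fin n)) ∈ K := by
    intro i t ht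
    refine ⟨fun j => if j = i then t else 0, fun j => ?_, ?_⟩
    · dsimp only
      split_ifs
      · exact ht
      · exact le_rfl
    · simp only [ite_smul, zero_smul, Finset.sum_ite_eq', Finset.mem_univ, if_true]
  have h0 : (0 : EuclideanSpace ℝ (Fin n)) ∈ K := ⟨0, by simp, by simp⟩
  have hcl : closure K = Set.univ := by
    by_contra hcl
    obtain ⟨q, hq⟩ := (Set.ne_univ_iff_exists_notMem _).1 hcl
    obtain ⟨f, b, hf, hfq⟩ := geometric_hahn_banach_closed_point hKconv.closure isClosed_closure hq
    have hb : 0 < b := by simpa using hf 0 (subset_closure h0)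
    have hfm : ∀ m ∈ N, f m ≤ 0 := by
      intro m hm
      by_contra! hpos
      have := hf _ (subset_closure (hmem ⟨m, hm⟩ (b / f m) (by positivity)))
      rw [map_smul, smul_eq_mul, div_mul_cancel₀ _ hpos.ne'] at this
      exact lt_irrefl _ this
    obtain ⟨w, hw⟩ := exists_vec (f : EuclideanSpace ℝ (Fin n) →ₗ[ℝ] ℝ)
    have hw0 : w ≠ 0 := by
      rintro rfl
      have := hw q
      simp only [inner_zero_left, ContinuousLinearMap.coe_coe] at this
      linarith
    obtain ⟨x, hx⟩ := hne
    obtain ⟨R, hR⟩ := hcomp.isBounded.exists_norm_le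
    have hray : ∀ t : ℝ, 0 ≤ t → x + t • w ∈ P := by
      intro t ht
      rw [hP] at hx ⊢
      intro m hm
      rw [inner_add_right, real_inner_smul_right, real_inner_comm]
      have h1 : ⟪m, w⟫ ≤ 0 := by
        rw [real_inner_comm, hw]; exact hfm m hm
      have h2 := hx m hm
      rw [real_inner_comm] at h2
      nlinarith
    have hwn : 0 < ‖w‖ := norm_pos_iff.2 hw0
    have hR0 : ‖x‖ ≤ R := hR x hx
    have hRnn : 0 ≤ R := (norm_nonneg _).trans hR0
    have hbig := hR _ (hray ((2 * R + 1) / ‖w‖) (by positivity))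
    have h3 : ‖((2 * R + 1) / ‖w‖) • w‖ = 2 * R + 1 := by
      rw [norm_smul, Real.norm_of_nonneg (by positivity), div_mul_cancel₀ _ hwn.ne']
    have h4 : ‖((2 * R + 1) / ‖w‖) • w‖ ≤ ‖x + ((2 * R + 1) / ‖w‖) • w‖ + ‖x‖ := by
      have := norm_sub_le (x + ((2 * R + 1) / ‖w‖) • w) x
      simpa using this
    linarith
  have haff : affineSpan ℝ K = ⊤ := by
    rw [eq_top_iff]
    intro q _
    have hc : IsClosed (affineSpan ℝ K : Set (EuclideanSpace ℝ (Fin n))) :=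
      AffineSubspace.closed_of_finiteDimensional _
    have : closure K ⊆ (affineSpan ℝ K : Set (EuclideanSpace ℝ (Fin n))) :=
      closure_minimal (subset_affineSpan ℝ K) hc
    exact this (hcl ▸ Set.mem_univ q)
  have hint := hKconv.interior_nonempty_iff_affineSpan_eq_top.2 haff
  have h1 := hKconv.interior_closure_eq_interior_of_nonempty_interior hint
  rw [hcl, interior_univ] at h1
  have : z ∈ interior K := h1 ▸ Set.mem_univ z
  have hzK : z ∈ K := interior_subset this
  exact hzK

/-- Main theorem: a strongly monotypic polytope (no `n+1` facet normals in conical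
position) can be illuminated by at most `2ⁿ` directions. -/
theorem stmt18 {n : ℕ} (N : Finset (EuclideanSpace ℝ (Fin n)))
    (h : EuclideanSpace ℝ (Fin n) → ℝ) (P : Set (EuclideanSpace ℝ (Fin n)))
    (hP : P = {p | ∀ m ∈ N, ⟪m, p⟫ ≤ h m})
    (hcomp : IsCompact P) (hint : (interior P).Nonempty)
    (hmono : ∀ S : Finset (EuclideanSpace ℝ (Fin n)),
      S ⊆ N → S.card = n + 1 → ¬ InConicalPos (S : Set (EuclideanSpace ℝ (Fin n)))) :
    ∃ V : Finset (EuclideanSpace ℝ (Fin n)), V.card ≤ 2 ^ n ∧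
      ∀ x ∈ frontier P, ∃ v ∈ V, x - v ∈ interior P := by
  classical
  -- pass to an irredundant subsystem
  obtain ⟨M, hMQ, hMmin⟩ := Finset.exists_min_image
    (N.powerset.filter (fun M => P = {p | ∀ m ∈ M, ⟪m, p⟫ ≤ h m})) Finset.card
    ⟨N, by simp only [Finset.mem_filter, Finset.mem_powerset]; exact ⟨subset_rfl, hP⟩⟩
  simp only [Finset.mem_filter, Finset.mem_powerset] at hMQ hMmin
  obtain ⟨hMN, hPM⟩ := hMQ
  obtain ⟨x₀, hx₀⟩ := hint
  have hx₀P : x₀ ∈ P := interior_subset hx₀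
  have hirr : ∀ m ∈ M, ¬ (∀ p, (∀ m' ∈ M.erase m, ⟪m', p⟫ ≤ h m') → ⟪m, p⟫ ≤ h m) := by
    intro m hm hred
    have := hMmin (M.erase m) ⟨(Finset.erase_subset _ _).trans hMN, by
      rw [hPM]
      ext p
      constructor
      · exact fun hp m' hm' => hp m' (Finset.mem_of_mem_erase hm')
      · intro hp m' hm'
        by_cases hmm : m' = m
        · rw [hmm]; exact hred p hp
        · exact hp m' (Finset.mem_erase.2 ⟨hmm, hm'⟩)⟩
    rw [Finset.card_erase_of_mem hm] at this
    have := Finset.card_pos.2 ⟨m, hm⟩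
    omega
  have hmemP : ∀ {p}, p ∈ P → ∀ m ∈ M, ⟪m, p⟫ ≤ h m := by
    intro p hp; rw [hPM] at hp; exact hp
  have hnz : ∀ m ∈ M, m ≠ 0 := by
    rintro m hm rfl
    refine hirr 0 hm (fun p _ => ?_)
    have := hmemP hx₀P 0 hm
    simpa using this
  have hstrict : ∀ m ∈ M, ⟪m, x₀⟫ < h m := by
    intro m hm
    have hnhds : P ∈ nhds x₀ := mem_interior_iff_mem_nhds.1 hx₀
    have hcont : Filter.Tendsto (fun t : ℝ => x₀ + t • m) (nhds 0) (nhds x₀) := by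
      have : Continuous (fun t : ℝ => x₀ + t • m) := by fun_prop
      simpa using this.tendsto 0
    have hev := (hcont.eventually hnhds).filter_mono (nhdsWithin_le_nhds (s := Set.Ioi 0))
    obtain ⟨t, ht, htpos⟩ := (hev.and self_mem_nhdsWithin).exists
    have h1 := hmemP ht m hm
    rw [inner_add_right, real_inner_smul_right] at h1
    have h2 : 0 < ⟪m, m⟫ := real_inner_self_pos.2 (hnz m hm)
    have htpos' : (0 : ℝ) < t := htpos
    nlinarith
  have hPconv : Convex ℝ P := by
    rw [hPM]
    intro p hp q hq s t hs ht hst m hm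
    rw [inner_add_right, real_inner_smul_right, real_inner_smul_right]
    have h1 := hp m hm
    have h2 := hq m hm
    calc s * ⟪m, p⟫ + t * ⟪m, q⟫ ≤ s * h m + t * h m :=
          add_le_add (mul_le_mul_of_nonneg_left h1 hs) (mul_le_mul_of_nonneg_left h2 ht)
      _ = h m := by rw [← add_mul, hst, one_mul]
  have hintP : ∀ p, (∀ m ∈ M, ⟪m, p⟫ < h m) → p ∈ interior P := by
    intro p hp
    rw [mem_interior_iff_mem_nhds]
    have : ∀ᶠ q in nhds p, ∀ m ∈ M, ⟪m, q⟫ < h m := by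
      rw [Filter.eventually_all_finset]
      intro m hm
      have hc : Continuous (fun q : EuclideanSpace ℝ (Fin n) => ⟪m, q⟫) := by fun_prop
      exact (hc.tendsto p).eventually_lt_const (hp m hm)
    filter_upwards [this] with q hq
    rw [hPM]
    exact fun m hm => (hq m hm).le
  have hpos := pos_span M h P hPM hcomp ⟨x₀, hx₀P⟩
  have hspan : Submodule.span ℝ (M : Set (EuclideanSpace ℝ (Fin n))) = ⊤ := by
    rw [eq_top_iff]
    intro z _
    obtain ⟨c, -, rfl⟩ := hpos z
    exact Submodule.sum_mem _ (fun i _ => Submodule.smul_mem _ _ (Submodule.subset_span i.2))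
  have hI := indep_of_conical M hspan (fun S hS hc => hmono S (hS.trans hMN) hc)
  obtain ⟨F, hFc, hFφ, hFcov⟩ := cover_aux n (EuclideanSpace ℝ (Fin n)) (by simp)
    (fun i : {m // m ∈ M} => (i : EuclideanSpace ℝ (Fin n))) hpos
  have hFv : ∀ Y : Finset {m // m ∈ M}, ∃ v : EuclideanSpace ℝ (Fin n), Y ∈ F →
      ∀ y ∈ Y, 0 < ⟪v, (y : EuclideanSpace ℝ (Fin n))⟫ := by
    intro Y
    by_cases hY : Y ∈ F
    · obtain ⟨φ, hφ⟩ := hFφ Y hY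
      obtain ⟨v, hv⟩ := exists_vec φ
      exact ⟨v, fun _ y hy => by rw [hv]; exact hφ y hy⟩
    · exact ⟨0, fun h => absurd h hY⟩
  choose dir hdir using hFv
  -- the local statement
  have hlocal : ∀ x ∈ P, ∃ Y ∈ F, ∃ k : ℕ, x - (1 / ((k : ℝ) + 1)) • dir Y ∈ interior P := by
    intro x hx
    let A := M.filter (fun m => ⟪m, x⟫ = h m)
    obtain ⟨Y, hY, d, hd, hdY, hs⟩ := hFcov (∑ a ∈ A, a)
    have hAv := local_dir M hI A (Finset.filter_subset _ _) (x - x₀)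
      (by
        intro a ha
        obtain ⟨haM, hax⟩ := Finset.mem_filter.1 ha
        rw [real_inner_comm, inner_sub_right, hax]
        linarith [hstrict a haM])
      (by
        rintro m hm ⟨t, c, ht, hc, hsum⟩
        refine hirr m hm (fun p hp => ?_)
        have h1 : ⟪m, p⟫ = ∑ z ∈ t, c z * ⟪z, p⟫ := by
          rw [← hsum, sum_inner]
          simp only [real_inner_smul_left]
        have h2 : ⟪m, x⟫ = ∑ z ∈ t, c z * ⟪z, x⟫ := by
          rw [← hsum, sum_inner]
          simp only [real_inner_smul_left]
        refine le_trans ?_ (hmemP hx m hm)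
        rw [h1, h2]
        refine Finset.sum_le_sum (fun z hz => mul_le_mul_of_nonneg_left ?_ (hc z hz))
        obtain ⟨hzA, hzm⟩ := ht hz
        obtain ⟨hzM, hzx⟩ := Finset.mem_filter.1 (Finset.mem_coe.1 hzA)
        rw [hzx]
        exact hp z (Finset.mem_erase.2 ⟨hzm, hzM⟩))
      Y (dir Y) (hdir Y hY) d hd hdY hs
    refine ⟨Y, hY, ?_⟩
    have hev : ∀ᶠ k : ℕ in Filter.atTop, ∀ m ∈ M,
        ⟪m, x - (1 / ((k : ℝ) + 1)) • dir Y⟫ < h m := by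
      rw [Filter.eventually_all_finset]
      intro m hm
      by_cases hmx : ⟪m, x⟫ = h m
      · refine Filter.Eventually.of_forall (fun k => ?_)
        have h1 := hAv m (Finset.mem_filter.2 ⟨hm, hmx⟩)
        rw [real_inner_comm] at h1
        rw [inner_sub_right, real_inner_smul_right, hmx]
        have : 0 < 1 / ((k : ℝ) + 1) * ⟪m, dir Y⟫ := by positivity
        linarith
      · have hlt : ⟪m, x⟫ < h m := lt_of_le_of_ne (hmemP hx m hm) hmx
        have hc : Continuous (fun t : ℝ => ⟪m, x - t • dir Y⟫) := by fun_prop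
        have h2 := (hc.tendsto 0).comp (tendsto_one_div_add_atTop_nhds_zero_nat (𝕜 := ℝ))
        simp only [zero_smul, sub_zero] at h2
        exact h2.eventually_lt_const hlt
    obtain ⟨k, hk⟩ := hev.exists
    exact ⟨k, hintP _ hk⟩
  -- uniform step size by compactness
  obtain ⟨T, hT⟩ := hcomp.elim_finite_subcover
    (fun k : ℕ => ⋃ Y ∈ F, (fun x => x - (1 / ((k : ℝ) + 1)) • dir Y) ⁻¹' interior P)
    (fun k => isOpen_biUnion (fun Y _ => isOpen_interior.preimage (by fun_prop)))
    (by
      intro x hx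
      obtain ⟨Y, hY, k, hk⟩ := hlocal x hx
      exact Set.mem_iUnion.2 ⟨k, Set.mem_biUnion hY hk⟩)
  let K := T.sup id
  refine ⟨F.image (fun Y => (1 / ((K : ℝ) + 1)) • dir Y), Finset.card_image_le.trans hFc, ?_⟩
  intro x hxf
  have hx : x ∈ P := hcomp.isClosed.frontier_subset hxf
  obtain ⟨k, hkT, hk⟩ := Set.mem_iUnion₂.1 (hT hx)
  obtain ⟨Y, hY, hxY⟩ := Set.mem_iUnion₂.1 hk
  refine ⟨_, Finset.mem_image_of_mem _ hY, ?_⟩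
  have hkK : (k : ℝ) ≤ K := by exact_mod_cast Finset.le_sup (f := id) hkT
  have hk0 : (0 : ℝ) < (k : ℝ) + 1 := by positivity
  have hK0 : (0 : ℝ) < (K : ℝ) + 1 := by positivity
  have hxY' : x - (1 / ((k : ℝ) + 1)) • dir Y ∈ interior P := hxY
  have := hPconv.combo_self_interior_mem_interior hx hxY'
    (a := 1 - ((k : ℝ) + 1) / ((K : ℝ) + 1)) (b := ((k : ℝ) + 1) / ((K : ℝ) + 1))
    (by rw [sub_nonneg, div_le_one hK0]; linarith) (by positivity) (by ring)
  convert this using 1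
  rw [smul_sub, smul_smul, sub_smul, one_smul]
  have h5 : ((k : ℝ) + 1) / ((K : ℝ) + 1) * (1 / ((k : ℝ) + 1)) = 1 / ((K : ℝ) + 1) := by
    field_simp
  rw [h5]
  abel
end
end
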